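/- arXiv:1207.6453 — 3 statements merged into one kernel-verified Lean document; each statement's English description precedes it below -/
import Mathlib

section
/- The function G_+ attains its global maximum value 9 at x = 0 (so sup_{x} G_+(x) = 9 = G_+(0)), while the function G_− satisfies the strict global bound sup_{x ∈ ℝ} G_−(x) < 8.662. -/
open MeasureTheory

/-- `G₊(x) = |1 + e(x) + e(7x)|² = 3 + 2(cos 2πx + cos 12πx + cos 14πx)`. -/
noncomputable def Gp (x : ℝ) : ℝ :=
  3 + 2 * (Real.cos (2 * Real.pi * x) + Real.cos (12 * Real.pi * x) + Real.cos (14 * Real.pi * x))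

/-- `G₋(x) = |1 + e(x) − e(7x)|² = 3 + 2(cos 2πx − cos 12πx − cos 14πx)`. -/
noncomputable def Gm (x : ℝ) : ℝ :=
  3 + 2 * (Real.cos (2 * Real.pi * x) - Real.cos (12 * Real.pi * x) - Real.cos (14 * Real.pi * x))

/-- The quotient in the Euclidean division of `8.661 - Gm` by `(c - 0.8893)²`,
both seen as polynomials in `c = cos 2πx`. -/
noncomputable def quotGm (c : ℝ) : ℝ :=
  128 * c ^ 5 + 182288 / 625 * c ^ 4 + 151186347 / 781250 * c ^ 3 + 34239831707 / 1953125000 * c ^ 2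
    - 154136309640399 / 15625000000000 * c + 1793084063374595579 / 390625000000000000

/-- Nonnegativity of the Bernstein products on `[l, u]`. -/
theorem sub_pow_mul_sub_pow_nonneg {l u c : ℝ} (hl : l ≤ c) (hu : c ≤ u) (i j : ℕ) :
    0 ≤ (c - l) ^ i * (u - c) ^ j :=
  mul_nonneg (pow_nonneg (sub_nonneg.2 hl) i) (pow_nonneg (sub_nonneg.2 hu) j)

theorem one_le_quotGm {c : ℝ} (hl : -1 ≤ c) (hu : c ≤ 1) : 1 ≤ quotGm c := by
  unfold quotGm
  rcases le_total c (-1 / 2) with h | h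
  · have b := sub_pow_mul_sub_pow_nonneg hl h
    linarith [b 0 5, b 1 4, b 2 3, b 3 2, b 4 1, b 5 0]
  rcases le_total c 0 with h' | h'
  · have b := sub_pow_mul_sub_pow_nonneg h h'
    linarith [b 0 5, b 1 4, b 2 3, b 3 2, b 4 1, b 5 0]
  · have b := sub_pow_mul_sub_pow_nonneg h' hu
    linarith [b 0 5, b 1 4, b 2 3, b 3 2, b 4 1, b 5 0]

theorem Gm_eq_polynomial (x : ℝ) :
    Gm x = 8.661 - (128 * Real.cos (2 * Real.pi * x) ^ 7 + 64 * Real.cos (2 * Real.pi * x) ^ 6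
      - 224 * Real.cos (2 * Real.pi * x) ^ 5 - 96 * Real.cos (2 * Real.pi * x) ^ 4
      + 112 * Real.cos (2 * Real.pi * x) ^ 3 + 36 * Real.cos (2 * Real.pi * x) ^ 2
      - 16 * Real.cos (2 * Real.pi * x) + 3.661) := by
  have e6 : 12 * Real.pi * x = 6 * (2 * Real.pi * x) := by ring
  have e7 : 14 * Real.pi * x = 7 * (2 * Real.pi * x) := by ring
  have t (n : ℤ) (y : ℝ) := congrArg (Polynomial.eval y) (Polynomial.Chebyshev.T_add_two ℝ n)
  have t0 := t 0 (Real.cos (2 * Real.pi * x))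
  have t1 := t 1 (Real.cos (2 * Real.pi * x))
  have t2 := t 2 (Real.cos (2 * Real.pi * x))
  have t3 := t 3 (Real.cos (2 * Real.pi * x))
  have t4 := t 4 (Real.cos (2 * Real.pi * x))
  have t5 := t 5 (Real.cos (2 * Real.pi * x))
  norm_num at t0 t1 t2 t3 t4 t5
  unfold Gm
  rw [e6, e7, t5, t4, t3, t2, t1, t0]
  ring

theorem Gm_le (x : ℝ) : Gm x ≤ 8.661 := by
  rw [Gm_eq_polynomial]
  have hq := one_le_quotGm (Real.neg_one_le_cos (2 * Real.pi * x)) (Real.cos_le_one _)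
  have hc := Real.cos_le_one (2 * Real.pi * x)
  generalize Real.cos (2 * Real.pi * x) = c at hq hc ⊢
  unfold quotGm at hq
  have h := mul_nonneg (sq_nonneg (c - 8893 / 10000)) (sub_nonneg.2 hq)
  have h' := sq_nonneg (c - 8893 / 10000 - 17 / 1000)
  linarith

theorem Gp_zero : Gp 0 = 9 := by
  norm_num [Gp]

theorem Gp_le (x : ℝ) : Gp x ≤ 9 := by
  unfold Gp
  linarith [Real.cos_le_one (2 * Real.pi * x), Real.cos_le_one (12 * Real.pi * x),
    Real.cos_le_one (14 * Real.pi * x)]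

theorem stmt4 :
    sSup (Set.range Gp) = 9 ∧ Gp 0 = 9 ∧ (∀ x, Gp x ≤ 9) ∧
    sSup (Set.range Gm) < 8.662 := by
  refine ⟨?_, Gp_zero, Gp_le, ?_⟩
  · exact IsGreatest.csSup_eq ⟨⟨0, Gp_zero⟩, Set.forall_mem_range.2 Gp_le⟩
  · exact (csSup_le (Set.range_nonempty Gm) (Set.forall_mem_range.2 Gm_le)).trans_lt (by norm_num)
end

section
/- The total variation of G_+ over one period is less than 74, and likewise the total variation of G_− over one period is less than 74. -/
open MeasureTheory

open Set

/-- If increments of `f` are dominated by those of `g`, so is the variation. -/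
lemma eVariationOn_le_of_abs_sub_le {f g : ℝ → ℝ} {s : Set ℝ}
    (h : ∀ x ∈ s, ∀ y ∈ s, x ≤ y → |f y - f x| ≤ |g y - g x|) :
    eVariationOn f s ≤ eVariationOn g s := by
  refine iSup_le ?_
  rintro ⟨n, u, hu, us⟩
  refine le_trans (Finset.sum_le_sum fun i _ => ?_) (eVariationOn.sum_le hu us)
  rw [edist_dist, edist_dist, Real.dist_eq, Real.dist_eq]
  exact ENNReal.ofReal_le_ofReal (h _ (us i) _ (us (i + 1)) (hu i.le_succ))

/-- Variation of a function whose derivative is at least `-ε`. -/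
lemma eVariationOn_Icc_le_of_neg_le_deriv {f f' : ℝ → ℝ} {a b ε : ℝ} (hab : a ≤ b) (hε : 0 ≤ ε)
    (hf : ∀ x, HasDerivAt f (f' x) x) (h : ∀ x ∈ Icc a b, -ε ≤ f' x) :
    eVariationOn f (Icc a b) ≤ ENNReal.ofReal (f b - f a + 2 * ε * (b - a)) := by
  have hderiv (k x : ℝ) : HasDerivAt (fun x => f x + k * x) (f' x + k) x :=
    ((hf x).add ((hasDerivAt_id x).const_mul k)).congr_deriv (by rw [mul_one])
  have hmono : MonotoneOn (fun x => f x + ε * x) (Icc a b) := by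
    refine monotoneOn_of_deriv_nonneg (convex_Icc a b)
      (fun x _ => (hderiv ε x).continuousAt.continuousWithinAt)
      (fun x _ => (hderiv ε x).differentiableAt.differentiableWithinAt) fun x hx => ?_
    rw [(hderiv ε x).deriv]
    linarith [h x (interior_subset hx)]
  have hmono₂ : MonotoneOn (fun x => f x + 2 * ε * x) (Icc a b) := fun x hx y hy hxy => by
    have := hmono hx hy hxy
    have := mul_le_mul_of_nonneg_left hxy hε
    dsimp only at *
    linarith
  have hvar := hmono₂.eVariationOn_eq (left_mem_Icc.2 hab) (right_mem_Icc.2 hab)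
  rw [inter_self] at hvar
  refine (eVariationOn_le_of_abs_sub_le fun x hx y hy hxy => ?_).trans
    (hvar.le.trans (ENNReal.ofReal_le_ofReal (by linarith)))
  have := hmono hx hy hxy
  have := mul_le_mul_of_nonneg_left hxy hε
  refine le_trans ?_ (le_abs_self _)
  dsimp only at *
  exact abs_le.2 ⟨by linarith, by linarith⟩

/-- Variation on `[a, b]` of a function whose derivative is within `ε` of a multiple of a product
of linear factors none of which vanishes inside `(a, b)`. -/
lemma eVariationOn_Icc_le_of_deriv_near_prod {f f' : ℝ → ℝ} {a b ε L K : ℝ} (l : List ℝ)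
    (hab : a ≤ b) (hε : 0 ≤ ε) (hf : ∀ x, HasDerivAt f (f' x) x)
    (h : ∀ x ∈ Icc a b, |f' x - L * (l.map (x - ·)).prod| ≤ ε)
    (hl : ∀ r ∈ l, r ≤ a ∨ b ≤ r)
    (hK : f b - f a + 2 * ε * (b - a) ≤ K) (hK' : f a - f b + 2 * ε * (b - a) ≤ K) :
    eVariationOn f (Icc a b) ≤ ENNReal.ofReal K := by
  have hsign : ∀ x ∈ Icc a b, ∀ y ∈ Icc a b,
      0 ≤ (l.map (x - ·)).prod * (l.map (y - ·)).prod := by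
    intro x hx y hy
    clear h
    induction l with
    | nil => simp
    | cons r l ih =>
      simp only [List.map_cons, List.prod_cons]
      have h₁ : 0 ≤ (x - r) * (y - r) := by
        rcases hl r (by simp) with hr | hr
        · exact mul_nonneg (by linarith [hx.1]) (by linarith [hy.1])
        · exact mul_nonneg_of_nonpos_of_nonpos (by linarith [hx.2]) (by linarith [hy.2])
      have h₂ := ih fun r hr => hl r (by simp [hr])
      calc 0 ≤ _ := mul_nonneg h₁ h₂
        _ = _ := by ring
  by_cases hD : ∀ x ∈ Icc a b, 0 ≤ L * (l.map (x - ·)).prod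
  · refine (eVariationOn_Icc_le_of_neg_le_deriv hab hε hf fun x hx => ?_).trans
      (ENNReal.ofReal_le_ofReal hK)
    linarith [(abs_le.1 (h x hx)).1, hD x hx]
  · push Not at hD
    obtain ⟨y, hy, hneg⟩ := hD
    have hD' : ∀ x ∈ Icc a b, L * (l.map (x - ·)).prod ≤ 0 := fun x hx => by
      by_contra! hpos
      nlinarith [mul_neg_of_pos_of_neg hpos hneg,
        mul_nonneg (sq_nonneg L) (hsign x hx y hy)]
    have hvar : eVariationOn f (Icc a b) ≤ eVariationOn (-f) (Icc a b) :=
      eVariationOn_le_of_abs_sub_le fun x _ y _ _ => by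
        rw [Pi.neg_apply, Pi.neg_apply, ← abs_neg]
        exact le_of_eq (congrArg _ (by ring))
    refine (hvar.trans (eVariationOn_Icc_le_of_neg_le_deriv (f' := fun x => -f' x) hab hε
      (fun x => (hf x).neg) fun x hx => ?_)).trans (ENNReal.ofReal_le_ofReal ?_)
    · linarith [(abs_le.1 (h x hx)).2, hD' x hx]
    · simp only [Pi.neg_apply]
      linarith

lemma eVariationOn_Icc_le_add {f : ℝ → ℝ} {a b c u v : ℝ} (hab : a ≤ b) (hbc : b ≤ c)
    (hu : 0 ≤ u) (hv : 0 ≤ v) (h₁ : eVariationOn f (Icc a b) ≤ ENNReal.ofReal u)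
    (h₂ : eVariationOn f (Icc b c) ≤ ENNReal.ofReal v) :
    eVariationOn f (Icc a c) ≤ ENNReal.ofReal (u + v) := by
  have := eVariationOn.Icc_add_Icc f hab hbc (mem_univ b)
  simp only [univ_inter] at this
  rw [← this, ENNReal.ofReal_add hu hv]
  exact add_le_add h₁ h₂

/-- A function of `cos (2πx)` has over one period at most twice the variation of the outer function
on `[-1, 1]`. -/
lemma eVariationOn_comp_cos_le {f : ℝ → ℝ} {u : ℝ} (hu : 0 ≤ u)
    (h : eVariationOn f (Icc (-1) 1) ≤ ENNReal.ofReal u) :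
    eVariationOn (fun x => f (Real.cos (2 * Real.pi * x))) (Icc (-(1 : ℝ) / 2) (1 / 2)) ≤
      ENNReal.ofReal (u + u) := by
  have hmaps (s : Set ℝ) : MapsTo (fun x => Real.cos (2 * Real.pi * x)) s (Icc (-1) 1) :=
    fun x _ => Real.cos_mem_Icc _
  have hπ := Real.pi_pos
  have hanti : AntitoneOn (fun x => Real.cos (2 * Real.pi * x)) (Icc 0 (1 / 2)) :=
    fun x hx y hy hxy => Real.cos_le_cos_of_nonneg_of_le_pi
      (mul_nonneg (by positivity) hx.1) (by nlinarith [hy.2])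
      (mul_le_mul_of_nonneg_left hxy (by positivity))
  have hmono : MonotoneOn (fun x => Real.cos (2 * Real.pi * x)) (Icc (-(1 : ℝ) / 2) 0) := by
    intro x hx y hy hxy
    have := hanti (a := -y) (b := -x) ⟨by linarith [hy.2], by linarith [hy.1]⟩
      ⟨by linarith [hx.2], by linarith [hx.1]⟩ (by linarith)
    simpa only [mul_neg, Real.cos_neg] using this
  exact eVariationOn_Icc_le_add (by norm_num) (by norm_num) hu hu
    ((eVariationOn.comp_le_of_monotoneOn f _ hmono (hmaps _)).trans h)
    ((eVariationOn.comp_le_of_antitoneOn f _ hanti (hmaps _)).trans h)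

lemma cos_six_mul (t : ℝ) :
    Real.cos (6 * t) = 32 * Real.cos t ^ 6 - 48 * Real.cos t ^ 4 + 18 * Real.cos t ^ 2 - 1 := by
  rw [show 6 * t = 2 * (3 * t) by ring, Real.cos_two_mul, Real.cos_three_mul]
  ring

lemma cos_seven_mul (t : ℝ) :
    Real.cos (7 * t) =
      64 * Real.cos t ^ 7 - 112 * Real.cos t ^ 5 + 56 * Real.cos t ^ 3 - 7 * Real.cos t := by
  have h := Real.cos_add_cos (7 * t) t
  rw [show (7 * t + t) / 2 = 2 * (2 * t) by ring, show (7 * t - t) / 2 = 3 * t by ring,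
    Real.cos_two_mul, Real.cos_two_mul, Real.cos_three_mul] at h
  linear_combination h

lemma hasDerivAt_septic (c₀ c₁ c₂ c₃ c₄ c₅ c₆ c₇ x : ℝ) :
    HasDerivAt (fun x : ℝ => c₀ + c₁ * x + c₂ * x ^ 2 + c₃ * x ^ 3 + c₄ * x ^ 4 + c₅ * x ^ 5 +
        c₆ * x ^ 6 + c₇ * x ^ 7)
      (c₁ + 2 * c₂ * x + 3 * c₃ * x ^ 2 + 4 * c₄ * x ^ 3 + 5 * c₅ * x ^ 4 + 6 * c₆ * x ^ 5 +
        7 * c₇ * x ^ 6) x := by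
  have h (k : ℕ) (c : ℝ) : HasDerivAt (fun x : ℝ => c * x ^ k) (c * (k * x ^ (k - 1))) x :=
    (hasDerivAt_pow k x).const_mul c
  have h₁ : HasDerivAt (fun x : ℝ => c₁ * x) (c₁ * 1) x := (hasDerivAt_id x).const_mul c₁
  refine (((((((h₁.const_add c₀).add (h 2 c₂)).add (h 3 c₃)).add (h 4 c₄)).add (h 5 c₅)).add
    (h 6 c₆)).add (h 7 c₇)).congr_deriv ?_
  norm_num
  ring

lemma abs_quintic_le {a₀ a₁ a₂ a₃ a₄ a₅ x : ℝ} (hx : x ∈ Icc (-1 : ℝ) 1) :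
    |a₀ + a₁ * x + a₂ * x ^ 2 + a₃ * x ^ 3 + a₄ * x ^ 4 + a₅ * x ^ 5| ≤
      |a₀| + |a₁| + |a₂| + |a₃| + |a₄| + |a₅| := by
  have h (k : ℕ) (a : ℝ) : |a * x ^ k| ≤ |a| := by
    rw [abs_mul, abs_pow]
    exact mul_le_of_le_one_right (abs_nonneg a) (pow_le_one₀ (abs_nonneg x) (abs_le.2 hx))
  have h₁ := h 1 a₁
  rw [pow_one] at h₁
  refine (abs_add_le _ _).trans (add_le_add ?_ (h 5 a₅))
  refine (abs_add_le _ _).trans (add_le_add ?_ (h 4 a₄))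
  refine (abs_add_le _ _).trans (add_le_add ?_ (h 3 a₃))
  refine (abs_add_le _ _).trans (add_le_add ?_ (h 2 a₂))
  exact (abs_add_le _ _).trans (add_le_add le_rfl h₁)

lemma eVariationOn_Gp_outer_le :
    eVariationOn (fun x : ℝ => 1 + (-12) * x + 36 * x ^ 2 + 112 * x ^ 3 +
        (-96) * x ^ 4 + (-224) * x ^ 5 + 64 * x ^ 6 + 128 * x ^ 7)
      (Icc (-1) 1) ≤ ENNReal.ofReal 36 := by
  have near : ∀ x ∈ Icc (-1 : ℝ) 1, |((-12) + 2 * 36 * x + 3 * 112 * x ^ 2 +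
      4 * (-96) * x ^ 3 + 5 * (-224) * x ^ 4 + 6 * 64 * x ^ 5 + 7 * 128 * x ^ 6) -
      896 * (([-4731 / 5000, -7427 / 10000, -3211 / 10000, 577 / 5000, 5819 / 10000, 4421 / 5000] :
        List ℝ).map (x - ·)).prod| ≤ 1 / 4 := by
    intro x hx
    refine le_trans (le_of_eq (congrArg _ ?_)) ((abs_quintic_le
      (a₀ := 4537152207770166027 / 976562500000000000000)
      (a₁ := 667592812965929 / 195312500000000000)
      (a₂ := -1188203081681 / 39062500000000)
      (a₃ := -333251089 / 7812500000)
      (a₄ := 8757 / 156250)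
      (a₅ := 8 / 125) hx).trans ?_)
    · simp only [List.map_cons, List.map_nil, List.prod_cons, List.prod_nil]
      ring
    · norm_num [abs_of_pos, abs_of_neg]
  have piece {a b K : ℝ} (ha : -1 ≤ a) (hab : a ≤ b) (hb : b ≤ 1) :=
    eVariationOn_Icc_le_of_deriv_near_prod (K := K) _ hab (by norm_num)
      (hasDerivAt_septic 1 (-12) 36 112 (-96) (-224) 64 128)
      fun x hx => near x ⟨ha.trans hx.1, hx.2.trans hb⟩
  have h0 := piece (a := -1) (b := -4731 / 5000) (K := 69 / 100)
    (by norm_num) (by norm_num) (by norm_num) (by norm_num) (by norm_num) (by norm_num)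
  have h1 := piece (a := -4731 / 5000) (b := -7427 / 10000) (K := 42 / 25)
    (by norm_num) (by norm_num) (by norm_num) (by norm_num) (by norm_num) (by norm_num)
  have h2 := piece (a := -7427 / 10000) (b := -3211 / 10000) (K := 119 / 25)
    (by norm_num) (by norm_num) (by norm_num) (by norm_num) (by norm_num) (by norm_num)
  have h3 := piece (a := -3211 / 10000) (b := 577 / 5000) (K := 23 / 5)
    (by norm_num) (by norm_num) (by norm_num) (by norm_num) (by norm_num) (by norm_num)
  have h4 := piece (a := 577 / 5000) (b := 5819 / 10000) (K := 769 / 100)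
    (by norm_num) (by norm_num) (by norm_num) (by norm_num) (by norm_num) (by norm_num)
  have h5 := piece (a := 5819 / 10000) (b := 4421 / 5000) (K := 697 / 100)
    (by norm_num) (by norm_num) (by norm_num) (by norm_num) (by norm_num) (by norm_num)
  have h6 := piece (a := 4421 / 5000) (b := 1) (K := 409 / 50)
    (by norm_num) (by norm_num) (by norm_num) (by norm_num) (by norm_num) (by norm_num)
  have h := eVariationOn_Icc_le_add (by norm_num) (by norm_num) (by norm_num) (by norm_num) h0 h1
  have h := eVariationOn_Icc_le_add (by norm_num) (by norm_num) (by norm_num) (by norm_num) h h2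
  have h := eVariationOn_Icc_le_add (by norm_num) (by norm_num) (by norm_num) (by norm_num) h h3
  have h := eVariationOn_Icc_le_add (by norm_num) (by norm_num) (by norm_num) (by norm_num) h h4
  have h := eVariationOn_Icc_le_add (by norm_num) (by norm_num) (by norm_num) (by norm_num) h h5
  have h := eVariationOn_Icc_le_add (by norm_num) (by norm_num) (by norm_num) (by norm_num) h h6
  exact h.trans (ENNReal.ofReal_le_ofReal (by norm_num))

lemma eVariationOn_Gm_outer_le :
    eVariationOn (fun x : ℝ => 5 + 16 * x + (-36) * x ^ 2 + (-112) * x ^ 3 +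
        96 * x ^ 4 + 224 * x ^ 5 + (-64) * x ^ 6 + (-128) * x ^ 7)
      (Icc (-1) 1) ≤ ENNReal.ofReal 36 := by
  have near : ∀ x ∈ Icc (-1 : ℝ) 1, |(16 + 2 * (-36) * x + 3 * (-112) * x ^ 2 +
      4 * 96 * x ^ 3 + 5 * 224 * x ^ 4 + 6 * (-64) * x ^ 5 + 7 * (-128) * x ^ 6) -
      (-896) * (([-957 / 1000, -7143 / 10000, -223 / 625, 73 / 500, 5641 / 10000, 8893 / 10000] :
        List ℝ).map (x - ·)).prod| ≤ 1 / 4 := by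
    intro x hx
    refine le_trans (le_of_eq (congrArg _ ?_)) ((abs_quintic_le
      (a₀ := -14637508281573239 / 2441406250000000000)
      (a₁ := 194220729065511 / 19531250000000000)
      (a₂ := 735265478087 / 39062500000000)
      (a₃ := -606283101 / 7812500000)
      (a₄ := 8631 / 781250)
      (a₅ := 72 / 625) hx).trans ?_)
    · simp only [List.map_cons, List.map_nil, List.prod_cons, List.prod_nil]
      ring
    · norm_num [abs_of_pos, abs_of_neg]
  have piece {a b K : ℝ} (ha : -1 ≤ a) (hab : a ≤ b) (hb : b ≤ 1) :=
    eVariationOn_Icc_le_of_deriv_near_prod (K := K) _ hab (by norm_num)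
      (hasDerivAt_septic 5 16 (-36) (-112) 96 224 (-64) (-128))
      fun x hx => near x ⟨ha.trans hx.1, hx.2.trans hb⟩
  have h0 := piece (a := -1) (b := -957 / 1000) (K := 49 / 100)
    (by norm_num) (by norm_num) (by norm_num) (by norm_num) (by norm_num) (by norm_num)
  have h1 := piece (a := -957 / 1000) (b := -7143 / 10000) (K := 13 / 5)
    (by norm_num) (by norm_num) (by norm_num) (by norm_num) (by norm_num) (by norm_num)
  have h2 := piece (a := -7143 / 10000) (b := -223 / 625) (K := 317 / 100)
    (by norm_num) (by norm_num) (by norm_num) (by norm_num) (by norm_num) (by norm_num)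
  have h3 := piece (a := -223 / 625) (b := 73 / 500) (K := 163 / 25)
    (by norm_num) (by norm_num) (by norm_num) (by norm_num) (by norm_num) (by norm_num)
  have h4 := piece (a := 73 / 500) (b := 5641 / 10000) (K := 59 / 10)
    (by norm_num) (by norm_num) (by norm_num) (by norm_num) (by norm_num) (by norm_num)
  have h5 := piece (a := 5641 / 10000) (b := 8893 / 10000) (K := 206 / 25)
    (by norm_num) (by norm_num) (by norm_num) (by norm_num) (by norm_num) (by norm_num)
  have h6 := piece (a := 8893 / 10000) (b := 1) (K := 193 / 25)
    (by norm_num) (by norm_num) (by norm_num) (by norm_num) (by norm_num) (by norm_num)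
  have h := eVariationOn_Icc_le_add (by norm_num) (by norm_num) (by norm_num) (by norm_num) h0 h1
  have h := eVariationOn_Icc_le_add (by norm_num) (by norm_num) (by norm_num) (by norm_num) h h2
  have h := eVariationOn_Icc_le_add (by norm_num) (by norm_num) (by norm_num) (by norm_num) h h3
  have h := eVariationOn_Icc_le_add (by norm_num) (by norm_num) (by norm_num) (by norm_num) h h4
  have h := eVariationOn_Icc_le_add (by norm_num) (by norm_num) (by norm_num) (by norm_num) h h5
  have h := eVariationOn_Icc_le_add (by norm_num) (by norm_num) (by norm_num) (by norm_num) h h6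
  exact h.trans (ENNReal.ofReal_le_ofReal (by norm_num))

theorem stmt6 :
    eVariationOn Gp (Set.Icc (-(1:ℝ)/2) (1/2)) < ENNReal.ofReal 74 ∧
    eVariationOn Gm (Set.Icc (-(1:ℝ)/2) (1/2)) < ENNReal.ofReal 74 := by
  constructor
  · have h := eVariationOn_comp_cos_le (by norm_num) eVariationOn_Gp_outer_le
    refine lt_of_le_of_lt (le_of_eq_of_le (congrArg (eVariationOn · _) (funext fun x => ?_)) h)
      ((ENNReal.ofReal_lt_ofReal_iff (by norm_num)).2 (by norm_num))
    rw [Gp, show 12 * Real.pi * x = 6 * (2 * Real.pi * x) by ring,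
      show 14 * Real.pi * x = 7 * (2 * Real.pi * x) by ring, cos_six_mul, cos_seven_mul]
    ring
  · have h := eVariationOn_comp_cos_le (by norm_num) eVariationOn_Gm_outer_le
    refine lt_of_le_of_lt (le_of_eq_of_le (congrArg (eVariationOn · _) (funext fun x => ?_)) h)
      ((ENNReal.ofReal_lt_ofReal_iff (by norm_num)).2 (by norm_num))
    rw [Gm, show 12 * Real.pi * x = 6 * (2 * Real.pi * x) by ring,
      show 14 * Real.pi * x = 7 * (2 * Real.pi * x) by ring, cos_six_mul, cos_seven_mul]
    ring
end

section
/- The second derivative of d at t = 5 is strictly positive: d''(5) > 0, where d''(5) = ∫₀^{1/2} G_−(x)⁵ (log G_−(x))² dx − ∫₀^{1/2} G_+(x)⁵ (log G_+(x))² dx. -/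
open MeasureTheory

/-- `d(t) = ∫₀^{1/2} (G₋ᵗ − G₊ᵗ)`, real powers (`0^t = 0` for `t ≠ 0`). -/
noncomputable def d (t : ℝ) : ℝ := ∫ x in (0:ℝ)..(1/2), (Gm x ^ t - Gp x ^ t)


section Deriv

theorem hasDerivAt_integral_mul_exp {g h : ℝ → ℝ} (hg : Continuous g) (hh : Continuous h)
    (a b t : ℝ) :
    HasDerivAt (fun t : ℝ => ∫ x in a..b, g x * Real.exp (t * h x))
      (∫ x in a..b, g x * h x * Real.exp (t * h x)) t := by
  obtain ⟨B, hB⟩ := (isCompact_uIcc (a := a) (b := b)).exists_bound_of_continuousOn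
    (f := fun x => g x * h x) (by fun_prop)
  obtain ⟨C, hC⟩ := (isCompact_uIcc (a := a) (b := b)).exists_bound_of_continuousOn
    (f := h) (by fun_prop)
  refine (intervalIntegral.hasDerivAt_integral_of_dominated_loc_of_deriv_le
    (bound := fun _ => B * Real.exp ((|t| + 1) * C)) (Metric.ball_mem_nhds t one_pos)
    (F := fun t x => g x * Real.exp (t * h x))
    (F' := fun t x => g x * h x * Real.exp (t * h x))
    ?_ ?_ ?_ ?_ ?_ ?_).2
  · exact Filter.Eventually.of_forall fun _ =>
      (by fun_prop : Continuous _).aestronglyMeasurable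
  · exact (by fun_prop : Continuous _).intervalIntegrable _ _
  · exact (by fun_prop : Continuous _).aestronglyMeasurable
  · refine Filter.Eventually.of_forall fun x hx u hu => ?_
    have hx' := Set.uIoc_subset_uIcc hx
    have hu' : |u| ≤ |t| + 1 := by
      rw [Metric.mem_ball, Real.dist_eq] at hu
      have := abs_sub_abs_le_abs_sub u t
      linarith
    have hCx := hC x hx'
    rw [Real.norm_eq_abs] at hCx
    rw [norm_mul, Real.norm_of_nonneg (Real.exp_pos _).le]
    refine mul_le_mul (hB x hx') (Real.exp_le_exp.2 ?_) (Real.exp_pos _).le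
      ((norm_nonneg _).trans (hB x hx'))
    calc u * h x ≤ |u * h x| := le_abs_self _
      _ = |u| * |h x| := abs_mul _ _
      _ ≤ (|t| + 1) * C := by gcongr
  · exact intervalIntegrable_const
  · refine Filter.Eventually.of_forall fun x _ u _ => ?_
    refine ((hasDerivAt_mul_const (h x)).exp.const_mul (g x)).congr_deriv ?_
    ring

theorem hasDerivAt_integral_mul_rpow {g G : ℝ → ℝ} (hg : Continuous g) (hG : Continuous G)
    (hpos : ∀ x, 0 < G x) (a b t : ℝ) :
    HasDerivAt (fun t => ∫ x in a..b, g x * G x ^ t)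
      (∫ x in a..b, g x * Real.log (G x) * G x ^ t) t := by
  have h := hasDerivAt_integral_mul_exp hg (hG.log fun x => (hpos x).ne') a b t
  simpa only [Real.rpow_def_of_pos (hpos _), mul_comm] using h

theorem iteratedDeriv_two_integral_rpow_sub {G H : ℝ → ℝ} (hG : Continuous G)
    (hH : Continuous H) (hG0 : ∀ x, 0 < G x) (hH0 : ∀ x, 0 < H x) (a b t : ℝ) :
    iteratedDeriv 2 (fun t : ℝ => ∫ x in a..b, (G x ^ t - H x ^ t)) t =
      (∫ x in a..b, G x ^ t * Real.log (G x) ^ 2) -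
        ∫ x in a..b, H x ^ t * Real.log (H x) ^ 2 := by
  have hlG : Continuous fun x => Real.log (G x) := hG.log fun x => (hG0 x).ne'
  have hlH : Continuous fun x => Real.log (H x) := hH.log fun x => (hH0 x).ne'
  have e0 : (fun t : ℝ => ∫ x in a..b, (G x ^ t - H x ^ t)) =
      fun t : ℝ => (∫ x in a..b, 1 * G x ^ t) - ∫ x in a..b, 1 * H x ^ t := by
    funext t
    simp only [one_mul]
    exact intervalIntegral.integral_sub
      (Continuous.intervalIntegrable (hG.rpow_const fun x => Or.inl (hG0 x).ne') _ _)
      (Continuous.intervalIntegrable (hH.rpow_const fun x => Or.inl (hH0 x).ne') _ _)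
  have e1 : deriv (fun t : ℝ => ∫ x in a..b, (G x ^ t - H x ^ t)) =
      fun t : ℝ => (∫ x in a..b, Real.log (G x) * G x ^ t) -
        ∫ x in a..b, Real.log (H x) * H x ^ t := by
    funext t
    rw [e0]
    refine Eq.trans ((hasDerivAt_integral_mul_rpow (continuous_const (y := 1)) hG hG0 a b t).sub
      (hasDerivAt_integral_mul_rpow (continuous_const (y := 1)) hH hH0 a b t)).deriv ?_
    simp only [one_mul]
  rw [iteratedDeriv_succ, iteratedDeriv_one, e1]
  refine ((hasDerivAt_integral_mul_rpow hlG hG hG0 a b t).sub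
    (hasDerivAt_integral_mul_rpow hlH hH hH0 a b t)).deriv.trans ?_
  congr 1 <;> refine intervalIntegral.integral_congr fun x _ => ?_ <;> ring

end Deriv

section Series

open Finset

theorem hasSum_of_eq {f g : ℕ → ℝ} {a b : ℝ} (h : HasSum f a) (hf : ∀ n, g n = f n)
    (hab : b = a) : HasSum g b := by
  rw [funext hf, hab]
  exact h

/-- The coefficients of `(1 - y) ∑ aₙ yⁿ`. -/
def backDiff (a : ℕ → ℝ) : ℕ → ℝ
  | 0 => a 0
  | n + 1 => a (n + 1) - a n

theorem hasSum_backDiff {a : ℕ → ℝ} {y S : ℝ} (h : HasSum (fun n => a n * y ^ n) S) :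
    HasSum (fun n => backDiff a n * y ^ n) ((1 - y) * S) := by
  rw [← hasSum_nat_add_iff' 1] at h ⊢
  have h' := (hasSum_nat_add_iff' 1).1 h
  have hy := ((hasSum_nat_add_iff' 1).2 h').sub (h'.mul_left y)
  convert hy using 1
  · funext n
    simp only [backDiff]
    ring
  · simp [backDiff]
    ring

/-- The harmonic numbers as reals. -/
noncomputable def harm (n : ℕ) : ℝ := ∑ i ∈ range n, 1 / ((i : ℝ) + 1)

theorem harm_succ (n : ℕ) : harm (n + 1) = harm n + 1 / ((n : ℝ) + 1) := sum_range_succ _ _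

theorem sum_antidiagonal_inv_mul_inv (n : ℕ) :
    ∑ p ∈ antidiagonal n, 1 / ((p.1 : ℝ) + 1) * (1 / ((p.2 : ℝ) + 1)) =
      2 * harm (n + 1) / (n + 2) := by
  have h1 : ∑ p ∈ antidiagonal n, 1 / ((p.1 : ℝ) + 1) = harm (n + 1) :=
    Nat.sum_antidiagonal_eq_sum_range_succ_mk (fun p : ℕ × ℕ => 1 / ((p.1 : ℝ) + 1)) n
  have h2 : ∑ p ∈ antidiagonal n, 1 / ((p.2 : ℝ) + 1) = harm (n + 1) := by
    rw [← h1, ← Nat.sum_antidiagonal_swap]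
    rfl
  have h3 : ∀ p ∈ antidiagonal n, 1 / ((p.1 : ℝ) + 1) * (1 / ((p.2 : ℝ) + 1)) =
      (1 / ((p.1 : ℝ) + 1) + 1 / ((p.2 : ℝ) + 1)) / (n + 2) := by
    intro p hp
    rw [HasAntidiagonal.mem_antidiagonal] at hp
    rw [← hp]
    push_cast
    have : (p.1 : ℝ) + p.2 + 2 ≠ 0 := by positivity
    field_simp
    ring
  rw [sum_congr rfl h3, ← sum_div, sum_add_distrib, h1, h2]
  ring

theorem hasSum_log_sq {y : ℝ} (hy : |y| < 1) :
    HasSum (fun n : ℕ => 2 * harm (n + 1) / (n + 2) * y ^ (n + 2)) (Real.log (1 - y) ^ 2) := by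
  have h := Real.hasSum_pow_div_log_of_abs_lt_one hy
  have hn : Summable fun n : ℕ => ‖y ^ (n + 1) / ((n : ℝ) + 1)‖ := by
    have := (Real.hasSum_pow_div_log_of_abs_lt_one (x := |y|) (by rwa [abs_abs])).summable
    refine this.congr fun n => ?_
    rw [norm_div, norm_pow, Real.norm_eq_abs, Real.norm_of_nonneg (by positivity)]
  have hs := (summable_norm_sum_mul_antidiagonal_of_summable_norm hn hn).of_norm.hasSum
  rw [← tsum_mul_tsum_eq_tsum_sum_antidiagonal_of_summable_norm hn hn, h.tsum_eq] at hs
  refine hasSum_of_eq hs (fun n => ?_) ?_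
  · rw [← sum_antidiagonal_inv_mul_inv, sum_mul]
    refine sum_congr rfl fun p hp => ?_
    rw [HasAntidiagonal.mem_antidiagonal] at hp
    rw [← hp]
    ring
  · ring

/-- The coefficients of `(L + log (1 - y))²` as a power series in `y`. -/
noncomputable def logSqCoeff (L : ℝ) : ℕ → ℝ
  | 0 => L ^ 2
  | n + 1 => 2 * (harm n - L) / (n + 1)

theorem hasSum_logSqCoeff (L : ℝ) {y : ℝ} (hy : |y| < 1) :
    HasSum (fun n => logSqCoeff L n * y ^ n) ((L + Real.log (1 - y)) ^ 2) := by
  have h1 := (Real.hasSum_pow_div_log_of_abs_lt_one hy).mul_left (-(2 * L))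
  have h2 : HasSum (fun n : ℕ => 2 * harm n / (n + 1) * y ^ (n + 1)) (Real.log (1 - y) ^ 2) := by
    rw [← hasSum_nat_add_iff' 1]
    refine hasSum_of_eq (hasSum_log_sq hy) (fun n => ?_) ?_
    · push_cast
      ring
    · simp [harm]
  rw [← hasSum_nat_add_iff' 1]
  refine hasSum_of_eq (h1.add h2) (fun n => ?_) ?_
  · simp only [logSqCoeff]
    ring
  · simp [logSqCoeff]
    ring

/-- The coefficients of `(1 - y)⁵ (L + log (1 - y))²`. -/
noncomputable def quinticLogSqCoeff (L : ℝ) : ℕ → ℝ := backDiff^[5] (logSqCoeff L)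

theorem hasSum_quinticLogSqCoeff (L : ℝ) {y : ℝ} (hy : |y| < 1) :
    HasSum (fun n => quinticLogSqCoeff L n * y ^ n)
      ((1 - y) ^ 5 * (L + Real.log (1 - y)) ^ 2) := by
  refine hasSum_of_eq (hasSum_backDiff (hasSum_backDiff (hasSum_backDiff (hasSum_backDiff
    (hasSum_backDiff (hasSum_logSqCoeff L hy)))))) (fun n => rfl) ?_
  ring

theorem quinticLogSqCoeff_add_six (L : ℝ) (m : ℕ) :
    quinticLogSqCoeff L (m + 6) = 240 * (L + 137 / 60 - harm m) /
      (((m : ℝ) + 1) * (m + 2) * (m + 3) * (m + 4) * (m + 5) * (m + 6)) := by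
  simp only [quinticLogSqCoeff, Function.iterate_succ, Function.iterate_zero, Function.comp,
    id, backDiff, logSqCoeff, harm_succ]
  push_cast
  have h1 : (m : ℝ) + 1 ≠ 0 := by positivity
  have h2 : (m : ℝ) + 2 ≠ 0 := by positivity
  have h3 : (m : ℝ) + 3 ≠ 0 := by positivity
  have h4 : (m : ℝ) + 4 ≠ 0 := by positivity
  have h5 : (m : ℝ) + 5 ≠ 0 := by positivity
  have h6 : (m : ℝ) + 6 ≠ 0 := by positivity
  simp only [add_assoc]
  norm_num
  field_simp
  ring

theorem harm_fourteen_add_mem (k : ℕ) :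
    harm 14 ≤ harm (k + 14) ∧ harm (k + 14) ≤ harm 14 + k / 15 := by
  induction k with
  | zero => simp
  | succ k ih =>
    rw [show k + 1 + 14 = k + 14 + 1 by ring, harm_succ (k + 14)]
    push_cast
    have h1 : 1 / ((k : ℝ) + 14 + 1) ≤ 1 / 15 :=
      one_div_le_one_div_of_le (by norm_num) (by linarith [(k.cast_nonneg : (0 : ℝ) ≤ k)])
    have h2 : 0 ≤ 1 / ((k : ℝ) + 14 + 1) := by positivity
    constructor <;> linarith [ih.1, ih.2]

/-- A telescoping majorant for the tails of the series of `quinticLogSqCoeff`. -/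
noncomputable def tailBound (k : ℕ) : ℝ :=
  6 / (((k : ℝ) + 16) * (k + 17) * (k + 18) * (k + 19))

theorem abs_quinticLogSqCoeff_le (k : ℕ) :
    |quinticLogSqCoeff (Real.log 5) (k + 20)| ≤ tailBound k - tailBound (k + 1) := by
  have hk : (0 : ℝ) ≤ k := k.cast_nonneg
  have h14 : harm 14 = 1171733 / 360360 := by
    norm_num [harm, sum_range_succ]
  have hD : |Real.log 5 + 137 / 60 - harm (k + 14)| ≤ ((k : ℝ) + 15) / 10 := by
    have h := harm_fourteen_add_mem k
    rw [h14] at h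
    rw [abs_le]
    constructor <;> linarith [h.1, h.2, Real.log_five_gt_d9, Real.log_five_lt_d9]
  have e : tailBound k - tailBound (k + 1) = 240 * (((k : ℝ) + 15) / 10) /
      (((k : ℝ) + 14 + 1) * (k + 14 + 2) * (k + 14 + 3) * (k + 14 + 4) * (k + 14 + 5) *
        (k + 14 + 6)) := by
    have h1 : (k : ℝ) + 15 ≠ 0 := by positivity
    have h2 : (k : ℝ) + 16 ≠ 0 := by positivity
    have h3 : (k : ℝ) + 17 ≠ 0 := by positivity
    have h4 : (k : ℝ) + 18 ≠ 0 := by positivity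
    have h5 : (k : ℝ) + 19 ≠ 0 := by positivity
    have h6 : (k : ℝ) + 20 ≠ 0 := by positivity
    simp only [tailBound]
    push_cast
    simp only [add_assoc]
    norm_num
    field_simp
    ring
  rw [e, show k + 20 = k + 14 + 6 by ring, quinticLogSqCoeff_add_six, abs_div, abs_mul,
    abs_of_nonneg (show (0 : ℝ) ≤ 240 by norm_num)]
  push_cast
  rw [abs_of_pos (show (0 : ℝ) < ((k : ℝ) + 14 + 1) * (k + 14 + 2) * (k + 14 + 3) *
    (k + 14 + 4) * (k + 14 + 5) * (k + 14 + 6) by positivity)]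
  gcongr

theorem abs_quintic_log_sq_sub_sum_le {y : ℝ} (hy : |y| < 1) :
    |(1 - y) ^ 5 * (Real.log 5 + Real.log (1 - y)) ^ 2 -
      ∑ n ∈ range 20, quinticLogSqCoeff (Real.log 5) n * y ^ n| ≤ tailBound 0 * y ^ 20 := by
  set a := quinticLogSqCoeff (Real.log 5)
  have hpart : ∀ K : ℕ, |∑ k ∈ range K, a (k + 20) * y ^ (k + 20)| ≤
      (tailBound 0 - tailBound K) * y ^ 20 := by
    intro K
    have h20 : |y| ^ 20 = y ^ 20 := Even.pow_abs (by decide) y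
    calc |∑ k ∈ range K, a (k + 20) * y ^ (k + 20)|
        ≤ ∑ k ∈ range K, |a (k + 20) * y ^ (k + 20)| := abs_sum_le_sum_abs _ _
      _ ≤ ∑ k ∈ range K, (tailBound k - tailBound (k + 1)) * y ^ 20 := by
          refine sum_le_sum fun k _ => ?_
          rw [abs_mul, abs_pow, ← h20]
          exact mul_le_mul (abs_quinticLogSqCoeff_le k)
            (pow_le_pow_of_le_one (abs_nonneg y) hy.le (by omega)) (by positivity)
            ((abs_nonneg _).trans (abs_quinticLogSqCoeff_le k))
      _ = (tailBound 0 - tailBound K) * y ^ 20 := by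
          rw [← sum_mul, sum_range_sub']
  have ht := ((hasSum_nat_add_iff' 20).2
    (hasSum_quinticLogSqCoeff (Real.log 5) hy)).tendsto_sum_nat.abs
  refine le_of_tendsto ht (Filter.Eventually.of_forall fun K => (hpart K).trans ?_)
  have : 0 ≤ tailBound K := by unfold tailBound; positivity
  have h20 : 0 ≤ y ^ 20 := Even.pow_nonneg (by decide) y
  nlinarith

end Series

section Moments

/-- The cosine sum `∑ₖ lₖ cos (2π (o + k) x)`. -/
noncomputable def cosSum (x : ℝ) : ℤ → List ℤ → ℝ
  | _, [] => 0
  | o, a :: l => a * Real.cos (2 * Real.pi * o * x) + cosSum x (o + 1) l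

/-- The coefficient of `cos 0` in the cosine sum starting at frequency `o`. -/
def constCoeff : ℤ → List ℤ → ℤ
  | _, [] => 0
  | o, a :: l => (if o = 0 then a else 0) + constCoeff (o + 1) l

/-- Coefficientwise sum of two lists of possibly different lengths. -/
def addCoeffs : List ℤ → List ℤ → List ℤ
  | [], m => m
  | a :: l, [] => a :: l
  | a :: l, b :: m => (a + b) :: addCoeffs l m

theorem cosSum_addCoeffs (x : ℝ) (o : ℤ) (l m : List ℤ) :
    cosSum x o (addCoeffs l m) = cosSum x o l + cosSum x o m := by
  induction l generalizing o m with
  | nil => simp [addCoeffs, cosSum]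
  | cons a l ih =>
    cases m with
    | nil => simp [addCoeffs, cosSum]
    | cons b m =>
      simp only [addCoeffs, cosSum, ih]
      push_cast
      ring

theorem cosSum_map_mul (x : ℝ) (o c : ℤ) (l : List ℤ) :
    cosSum x o (l.map (c * ·)) = c * cosSum x o l := by
  induction l generalizing o with
  | nil => simp [cosSum]
  | cons a l ih =>
    simp only [List.map, cosSum, ih]
    push_cast
    ring

theorem cosSum_replicate_append (x : ℝ) (o : ℤ) (n : ℕ) (l : List ℤ) :
    cosSum x o (List.replicate n 0 ++ l) = cosSum x (o + n) l := by
  induction n generalizing o with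
  | zero => simp
  | succ n ih =>
    simp only [List.replicate_succ, List.cons_append, cosSum, ih]
    push_cast
    rw [zero_mul, zero_add, add_assoc, add_comm 1 (n : ℤ)]

theorem two_cos_mul_cosSum (x : ℝ) (o j : ℤ) (l : List ℤ) :
    2 * Real.cos (2 * Real.pi * j * x) * cosSum x o l =
      cosSum x (o + j) l + cosSum x (o - j) l := by
  induction l generalizing o with
  | nil => simp [cosSum]
  | cons a l ih =>
    have h := ih (o + 1)
    simp only [cosSum]
    rw [mul_add, h, show o + 1 + j = o + j + 1 by ring, show o + 1 - j = o - j + 1 by ring]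
    have e1 : 2 * Real.pi * ((o + j : ℤ) : ℝ) * x =
      2 * Real.pi * o * x + 2 * Real.pi * j * x := by push_cast; ring
    have e2 : 2 * Real.pi * ((o - j : ℤ) : ℝ) * x =
      2 * Real.pi * o * x - 2 * Real.pi * j * x := by push_cast; ring
    rw [e1, e2, Real.cos_add, Real.cos_sub]
    ring

theorem continuous_cosSum (o : ℤ) (l : List ℤ) : Continuous fun x => cosSum x o l := by
  induction l generalizing o with
  | nil => exact continuous_const
  | cons a l ih =>
    have := ih (o + 1)
    simp only [cosSum]
    fun_prop

theorem integral_cos_two_pi_int_mul (o : ℤ) :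
    ∫ x in (0 : ℝ)..(1 / 2), Real.cos (2 * Real.pi * o * x) = if o = 0 then 1 / 2 else 0 := by
  split_ifs with h
  · simp [h]
  · have hc : 2 * Real.pi * (o : ℝ) ≠ 0 := by
      have : (o : ℝ) ≠ 0 := by exact_mod_cast h
      positivity
    rw [intervalIntegral.integral_comp_mul_left _ hc, integral_cos,
      show 2 * Real.pi * (o : ℝ) * (1 / 2) = o * Real.pi by ring, Real.sin_int_mul_pi]
    simp

theorem integral_cosSum (o : ℤ) (l : List ℤ) :
    ∫ x in (0 : ℝ)..(1 / 2), cosSum x o l = constCoeff o l / 2 := by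
  induction l generalizing o with
  | nil => simp [cosSum, constCoeff]
  | cons a l ih =>
    simp only [cosSum, constCoeff]
    rw [intervalIntegral.integral_add ((by fun_prop : Continuous _).intervalIntegrable _ _)
      ((continuous_cosSum _ _).intervalIntegrable _ _), ih, intervalIntegral.integral_const_mul,
      integral_cos_two_pi_int_mul]
    split_ifs <;> push_cast <;> ring

/-- `|1 + e(x) + s e(7x)|²` for a sign `s`. -/
noncomputable def normSqTrinomial (s : ℤ) (x : ℝ) : ℝ :=
  3 + 2 * (Real.cos (2 * Real.pi * x) +
    s * (Real.cos (12 * Real.pi * x) + Real.cos (14 * Real.pi * x)))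

/-- Multiplication of a cosine sum by `5 - normSqTrinomial s`, lowering the first frequency
by `7`. -/
def stepCoeffs (s : ℤ) (l : List ℤ) : List ℤ :=
  let n := l.map ((-1) * ·)
  let t := l.map ((-s) * ·)
  addCoeffs t <| addCoeffs (List.replicate 1 0 ++ t) <|
  addCoeffs (List.replicate 6 0 ++ n) <| addCoeffs (List.replicate 7 0 ++ l.map (2 * ·)) <|
  addCoeffs (List.replicate 8 0 ++ n) <| addCoeffs (List.replicate 13 0 ++ t) <|
  List.replicate 14 0 ++ t

theorem cosSum_stepCoeffs (s : ℤ) (x : ℝ) (o : ℤ) (l : List ℤ) :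
    cosSum x (o - 7) (stepCoeffs s l) = (5 - normSqTrinomial s x) * cosSum x o l := by
  have h1 := two_cos_mul_cosSum x o 1 l
  have h6 := two_cos_mul_cosSum x o 6 l
  have h7 := two_cos_mul_cosSum x o 7 l
  rw [show 2 * Real.pi * ((1 : ℤ) : ℝ) * x = 2 * Real.pi * x by push_cast; ring] at h1
  rw [show 2 * Real.pi * ((6 : ℤ) : ℝ) * x = 12 * Real.pi * x by push_cast; ring] at h6
  rw [show 2 * Real.pi * ((7 : ℤ) : ℝ) * x = 14 * Real.pi * x by push_cast; ring] at h7
  simp only [stepCoeffs, cosSum_addCoeffs, cosSum_replicate_append, cosSum_map_mul]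
  rw [show o - 7 + ((1 : ℕ) : ℤ) = o - 6 by push_cast; ring,
    show o - 7 + ((6 : ℕ) : ℤ) = o - 1 by push_cast; ring,
    show o - 7 + ((7 : ℕ) : ℤ) = o by push_cast; ring,
    show o - 7 + ((8 : ℕ) : ℤ) = o + 1 by push_cast; ring,
    show o - 7 + ((13 : ℕ) : ℤ) = o + 6 by push_cast; ring,
    show o - 7 + ((14 : ℕ) : ℤ) = o + 7 by push_cast; ring]
  unfold normSqTrinomial
  push_cast
  linear_combination h1 + (s : ℝ) * (h6 + h7)

/-- The first `n` constant coefficients of the iterates of `stepCoeffs s`. -/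
def momentList (s : ℤ) : ℤ → List ℤ → ℕ → List ℤ
  | _, _, 0 => []
  | o, l, n + 1 => constCoeff o l :: momentList s (o - 7) (stepCoeffs s l) n

theorem integral_pow_mul_cosSum (s o : ℤ) (l : List ℤ) {n k : ℕ} (hk : k < n) :
    ∫ x in (0 : ℝ)..(1 / 2), (5 - normSqTrinomial s x) ^ k * cosSum x o l =
      (momentList s o l n).getD k 0 / 2 := by
  induction n generalizing o l k with
  | zero => omega
  | succ n ih =>
    cases k with
    | zero => simpa [momentList] using integral_cosSum o l
    | succ k =>
      have h := ih (o - 7) (stepCoeffs s l) (k := k) (by omega)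
      simp only [cosSum_stepCoeffs] at h
      simp only [momentList, List.getD_cons_succ, pow_succ, mul_assoc]
      exact h

theorem integral_one_sub_div_five_pow {s : ℤ} {L : List ℤ} (hL : momentList s 0 [1] 21 = L)
    {k : ℕ} (hk : k < 21) :
    ∫ x in (0 : ℝ)..(1 / 2), (1 - normSqTrinomial s x / 5) ^ k = L.getD k 0 / (2 * 5 ^ k) := by
  have h := integral_pow_mul_cosSum s 0 [1] hk
  rw [hL] at h
  simp only [cosSum, Int.cast_one, Int.cast_zero, mul_zero, zero_mul, Real.cos_zero, add_zero,
    mul_one] at h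
  have e : ∀ x, (1 - normSqTrinomial s x / 5) ^ k = (5 - normSqTrinomial s x) ^ k / 5 ^ k := by
    intro x
    rw [← div_pow]
    ring
  simp only [e]
  rw [intervalIntegral.integral_div, h]
  ring

theorem momentList_one : momentList 1 0 [1] 21 =
    [1, 2, 10, 32, 154, 572, 2704, 10866, 51162, 216212, 1018720, 4458500, 21048592, 94465776,
      446970814, 2042992682, 9688002714, 44877506340, 213267215308, 997696938080,
      4750942281064] := by
  decide +kernel

theorem momentList_neg_one : momentList (-1) 0 [1] 21 =
    [1, 2, 10, 32, 154, 572, 2704, 10894, 50906, 215924, 1003960, 4409660, 20505808, 92328784,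
      430810670, 1975579622, 9265962394, 43087264900, 203284503868, 955623361184,
      4535481332584] := by
  decide +kernel

end Moments

section Trinomial

theorem continuous_normSqTrinomial (s : ℤ) : Continuous (normSqTrinomial s) := by
  unfold normSqTrinomial
  fun_prop

theorem normSqTrinomial_pos {s : ℤ} (hs : s ^ 2 = 1) (x : ℝ) : 0 < normSqTrinomial s x := by
  have hs' : (s : ℝ) ^ 2 = 1 := by exact_mod_cast hs
  set a := 2 * Real.pi * x with ha
  have e6 : Real.cos (12 * Real.pi * x) =
      Real.cos (7 * a) * Real.cos a + Real.sin (7 * a) * Real.sin a := by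
    rw [← Real.cos_sub]
    congr 1
    rw [ha]; ring
  have e6' : Real.cos (12 * Real.pi * x) = 2 * (4 * Real.cos a ^ 3 - 3 * Real.cos a) ^ 2 - 1 := by
    rw [← Real.cos_three_mul, ← Real.cos_two_mul]
    congr 1
    rw [ha]; ring
  have e7 : Real.cos (14 * Real.pi * x) = Real.cos (7 * a) := by
    congr 1
    rw [ha]; ring
  have h1 := Real.sin_sq_add_cos_sq a
  have h7 := Real.sin_sq_add_cos_sq (7 * a)
  have key : normSqTrinomial s x = (1 + Real.cos a + s * Real.cos (7 * a)) ^ 2 +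
      (Real.sin a + s * Real.sin (7 * a)) ^ 2 := by
    unfold normSqTrinomial
    rw [e7, e6]
    linear_combination (-1 : ℝ) * h1 - (s : ℝ) ^ 2 * h7 - hs'
  rw [e6] at e6'
  generalize Real.cos a = c, Real.sin a = d, Real.cos (7 * a) = C, Real.sin (7 * a) = D at *
  rw [key]
  refine lt_of_le_of_ne (by positivity) fun h0 => ?_
  have hA : 1 + c + s * C = 0 := by nlinarith [sq_nonneg (1 + c + s * C), sq_nonneg (d + s * D)]
  have hB : d + s * D = 0 := by nlinarith [sq_nonneg (1 + c + s * C), sq_nonneg (d + s * D)]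
  have hC : C = -s * (1 + c) := by linear_combination (s : ℝ) * hA - C * hs'
  have hD : D = -s * d := by linear_combination (s : ℝ) * hB - D * hs'
  subst hC hD
  have hc : c = -1 / 2 := by
    linear_combination (1 / 2) * h7 - (1 / 2) * h1 - (1 / 2) * ((1 + c) ^ 2 + d ^ 2) * hs'
  subst hc
  have hd : d ^ 2 = 3 / 4 := by linarith
  have : (s : ℝ) = -2 := by linear_combination (-2 : ℝ) * e6' - 2 * s * hd
  rw [this] at hs'
  norm_num at hs'

theorem normSqTrinomial_le {s : ℤ} (hs : s ^ 2 = 1) (x : ℝ) : normSqTrinomial s x ≤ 9 := by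
  unfold normSqTrinomial
  have h1 := Real.cos_le_one (2 * Real.pi * x)
  have h2 := Real.cos_le_one (12 * Real.pi * x)
  have h3 := Real.cos_le_one (14 * Real.pi * x)
  have h4 := Real.neg_one_le_cos (12 * Real.pi * x)
  have h5 := Real.neg_one_le_cos (14 * Real.pi * x)
  rcases sq_eq_sq_iff_eq_or_eq_neg.1 (hs.trans (one_pow 2).symm) with rfl | rfl <;>
    push_cast <;> linarith

theorem abs_integral_quintic_log_sq_sub_le {s : ℤ} (hs : s ^ 2 = 1) :
    |(∫ x in (0 : ℝ)..(1 / 2), normSqTrinomial s x ^ 5 * Real.log (normSqTrinomial s x) ^ 2) -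
      3125 * ∑ n ∈ Finset.range 20, quinticLogSqCoeff (Real.log 5) n *
        ∫ x in (0 : ℝ)..(1 / 2), (1 - normSqTrinomial s x / 5) ^ n| ≤
    3125 * tailBound 0 * ∫ x in (0 : ℝ)..(1 / 2), (1 - normSqTrinomial s x / 5) ^ 20 := by
  have hc := continuous_normSqTrinomial s
  have hlog : Continuous fun x => Real.log (normSqTrinomial s x) :=
    hc.log fun x => (normSqTrinomial_pos hs x).ne'
  have hsum : 3125 * ∑ n ∈ Finset.range 20, quinticLogSqCoeff (Real.log 5) n *
        ∫ x in (0 : ℝ)..(1 / 2), (1 - normSqTrinomial s x / 5) ^ n =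
      ∫ x in (0 : ℝ)..(1 / 2), 3125 * ∑ n ∈ Finset.range 20,
        quinticLogSqCoeff (Real.log 5) n * (1 - normSqTrinomial s x / 5) ^ n := by
    rw [intervalIntegral.integral_const_mul, intervalIntegral.integral_finsetSum]
    · simp only [intervalIntegral.integral_const_mul]
    · exact fun n _ => (by fun_prop : Continuous _).intervalIntegrable _ _
  rw [hsum, ← intervalIntegral.integral_sub
    ((by fun_prop : Continuous _).intervalIntegrable _ _)
    ((by fun_prop : Continuous _).intervalIntegrable _ _),
    ← intervalIntegral.integral_const_mul, ← Real.norm_eq_abs]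
  refine intervalIntegral.norm_integral_le_of_norm_le (by norm_num)
    (Filter.Eventually.of_forall fun x _ => ?_)
    ((by fun_prop : Continuous _).intervalIntegrable _ _)
  have hp := normSqTrinomial_pos hs x
  have hl := normSqTrinomial_le hs x
  have h := abs_quintic_log_sq_sub_sum_le (y := 1 - normSqTrinomial s x / 5)
    (by rw [abs_lt]; constructor <;> linarith)
  rw [sub_sub_cancel, ← Real.log_mul (by norm_num) (by positivity),
    mul_div_cancel₀ _ (by norm_num : (5 : ℝ) ≠ 0)] at h
  rw [Real.norm_eq_abs, mul_assoc]
  refine le_trans (le_of_eq ?_) (mul_le_mul_of_nonneg_left h (by norm_num : (0 : ℝ) ≤ 3125))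
  rw [← abs_of_pos (show (0 : ℝ) < 3125 by norm_num), ← abs_mul,
    abs_of_pos (show (0 : ℝ) < 3125 by norm_num)]
  congr 1
  ring

theorem integral_quintic_log_sq_lt :
    (∫ x in (0 : ℝ)..(1 / 2), normSqTrinomial 1 x ^ 5 * Real.log (normSqTrinomial 1 x) ^ 2) <
      ∫ x in (0 : ℝ)..(1 / 2),
        normSqTrinomial (-1) x ^ 5 * Real.log (normSqTrinomial (-1) x) ^ 2 := by
  have hp := (abs_le.1 (abs_integral_quintic_log_sq_sub_le (s := 1) (by norm_num))).2
  have hm := (abs_le.1 (abs_integral_quintic_log_sq_sub_le (s := -1) (by norm_num))).1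
  have hk : ∀ n ∈ Finset.range 20, n < 21 := fun n hn => by
    rw [Finset.mem_range] at hn; omega
  rw [integral_one_sub_div_five_pow momentList_one (by norm_num),
    Finset.sum_congr rfl fun n hn => by
      rw [integral_one_sub_div_five_pow momentList_one (hk n hn)]] at hp
  rw [integral_one_sub_div_five_pow momentList_neg_one (by norm_num),
    Finset.sum_congr rfl fun n hn => by
      rw [integral_one_sub_div_five_pow momentList_neg_one (hk n hn)]] at hm
  have hc := quinticLogSqCoeff_add_six (Real.log 5)
  have h7 := hc 1
  have h8 := hc 2
  have h9 := hc 3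
  have h10 := hc 4
  have h11 := hc 5
  have h12 := hc 6
  have h13 := hc 7
  have h14 := hc 8
  have h15 := hc 9
  have h16 := hc 10
  have h17 := hc 11
  have h18 := hc 12
  have h19 := hc 13
  norm_num [harm, Finset.sum_range_succ] at h7 h8 h9 h10 h11 h12 h13 h14 h15 h16 h17 h18 h19
  norm_num [Finset.sum_range_succ, tailBound, h7, h8, h9, h10, h11, h12, h13, h14, h15, h16,
    h17, h18, h19] at hp hm
  linarith [Real.log_five_gt_d9, Real.log_five_lt_d9]

end Trinomial

theorem Gp_eq_normSqTrinomial : Gp = normSqTrinomial 1 := by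
  funext x
  simp only [Gp, normSqTrinomial]
  push_cast
  ring

theorem Gm_eq_normSqTrinomial : Gm = normSqTrinomial (-1) := by
  funext x
  simp only [Gm, normSqTrinomial]
  push_cast
  ring

theorem stmt10 :
    iteratedDeriv 2 d 5 =
      (∫ x in (0:ℝ)..(1/2), Gm x ^ 5 * Real.log (Gm x) ^ 2) -
      (∫ x in (0:ℝ)..(1/2), Gp x ^ 5 * Real.log (Gp x) ^ 2) ∧
    0 < iteratedDeriv 2 d 5 := by
  have key : iteratedDeriv 2 d 5 =
      (∫ x in (0:ℝ)..(1/2), Gm x ^ 5 * Real.log (Gm x) ^ 2) -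
      (∫ x in (0:ℝ)..(1/2), Gp x ^ 5 * Real.log (Gp x) ^ 2) := by
    have h := iteratedDeriv_two_integral_rpow_sub (continuous_normSqTrinomial (-1))
      (continuous_normSqTrinomial 1) (normSqTrinomial_pos (by norm_num))
      (normSqTrinomial_pos (by norm_num)) 0 (1 / 2) 5
    rw [← Gp_eq_normSqTrinomial, ← Gm_eq_normSqTrinomial] at h
    have e : ∀ v : ℝ, v ^ (5 : ℝ) = v ^ 5 := fun v => by
      exact_mod_cast Real.rpow_natCast v 5
    simp only [e] at h
    exact h
  refine ⟨key, ?_⟩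
  rw [key, Gp_eq_normSqTrinomial, Gm_eq_normSqTrinomial]
  exact sub_pos.2 integral_quintic_log_sq_lt
end
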